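/- The class F(REG, REG) is not closed under union: there exist two languages, each generated by an F-system with regular core and regular folding procedure languages, whose union is not generated by any such F-system. In particular, { aⁿ#(bc)ⁿ : n ≥ 1 } and { (de)ⁿ#fⁿ : n ≥ 1 } each belong to F(REG, REG), but their union does not. -/

import Mathlib

/-- The folding direction alphabet Γ = {u, d}. -/
inductive FDir : Type
  | up : FDir
  | down : FDir
  deriving DecidableEq

/-- Auxiliary folding function operating on reversed words. -/
def foldRev {α : Type} : List α → List FDir → Option (List α)
  | [], [] => some []
  | a :: w, b :: v =>
      (foldRev w v).map fun x =>
        match b with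
        | FDir.up => a :: x
        | FDir.down => x ++ [a]
  | _, _ => none

/-- The folding function `h : Σ* × Γ* → Σ*` (partial, modeled with `Option`):
`h(ε, ε) = ε`; for `a ∈ Σ`, `h(w·a, v·u) = a·h(w, v)` and `h(w·a, v·d) = h(w, v)·a`;
`h(w, v)` is undefined (`none`) when `|w| ≠ |v|`. -/
def foldWord {α : Type} (w : List α) (v : List FDir) : Option (List α) :=
  foldRev w.reverse v.reverse

/-- The language of the F-system Φ = (L₁, L₂):
`L(Φ) = { h(w, v) : w ∈ L₁, v ∈ L₂, |w| = |v| }`. -/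
def FLang {α : Type} (L₁ : Language α) (L₂ : Language FDir) : Language α :=
  { s | ∃ w ∈ L₁, ∃ v ∈ L₂, w.length = v.length ∧ foldWord w v = some s }

/-- The alphabet Σ = {a, b, c, d, e, f, #} (`hash` stands for `#`). -/
inductive Sym7 : Type
  | a : Sym7
  | b : Sym7
  | c : Sym7
  | d : Sym7
  | e : Sym7
  | f : Sym7
  | hash : Sym7
  deriving DecidableEq

/-- The language `L = { aⁿ#(bc)ⁿ : n ≥ 1 } ∪ { (de)ⁿ#fⁿ : n ≥ 1 }`. -/
def Lpaper : Language Sym7 :=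
  { s | (∃ n : ℕ, 1 ≤ n ∧
      s = List.replicate n Sym7.a ++ [Sym7.hash] ++
          (List.replicate n [Sym7.b, Sym7.c]).flatten) ∨
    (∃ n : ℕ, 1 ≤ n ∧
      s = (List.replicate n [Sym7.d, Sym7.e]).flatten ++ [Sym7.hash] ++
          List.replicate n Sym7.f) }

/-- The sublanguage `{ aⁿ#(bc)ⁿ : n ≥ 1 }` of `Lpaper`. -/
def LpaperA : Language Sym7 :=
  { s | ∃ n : ℕ, 1 ≤ n ∧
      s = List.replicate n Sym7.a ++ [Sym7.hash] ++
          (List.replicate n [Sym7.b, Sym7.c]).flatten }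

/-- The sublanguage `{ (de)ⁿ#fⁿ : n ≥ 1 }` of `Lpaper`. -/
def LpaperB : Language Sym7 :=
  { s | ∃ n : ℕ, 1 ≤ n ∧
      s = (List.replicate n [Sym7.d, Sym7.e]).flatten ++ [Sym7.hash] ++
          List.replicate n Sym7.f }

/-! ### Folding lemmas -/

theorem foldRev_append_aux {α : Type} (w : List α) (v : List FDir) :
    ∀ (x : List α) (y : List FDir), x.length = y.length →
      ∃ L R : List α, (foldRev (x ++ w) (y ++ v) = (foldRev w v).map fun s => L ++ s ++ R) ∧
        foldRev x y = some (L ++ R) ∧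
        L.length = y.count FDir.up ∧ (L ++ R).Perm x := by
  intro x
  induction x with
  | nil =>
    intro y hy
    have : y = [] := by
      cases y with
      | nil => rfl
      | cons b y => simp at hy
    subst this
    refine ⟨[], [], ?_, ?_, ?_, ?_⟩ <;> simp [foldRev]
  | cons a x ih =>
    intro y hy
    cases y with
    | nil => simp at hy
    | cons b y =>
      obtain ⟨L, R, h1, h4, h2, h3⟩ := ih y (by simpa using hy)
      cases b with
      | up =>
        refine ⟨a :: L, R, ?_, ?_, ?_, ?_⟩
        · simp only [List.cons_append, foldRev, h1, Option.map_map]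
          rfl
        · simp [foldRev, h4]
        · simp [h2]
        · simpa using h3
      | down =>
        refine ⟨L, R ++ [a], ?_, ?_, ?_, ?_⟩
        · simp only [List.cons_append, foldRev, h1, Option.map_map]
          congr 1
          funext s
          simp
        · simp [foldRev, h4]
        · simp [h2]
        · rw [← List.append_assoc]
          exact (List.perm_append_singleton a (L ++ R)).trans (h3.cons a)

theorem foldWord_append {α : Type} (w x : List α) (v y : List FDir) (h : x.length = y.length) :
    ∃ L R : List α, (foldWord (w ++ x) (v ++ y) = (foldWord w v).map fun s => L ++ s ++ R) ∧
      L.length = y.count FDir.up ∧ (L ++ R).Perm x := by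
  obtain ⟨L, R, h1, _, h2, h3⟩ := foldRev_append_aux w.reverse v.reverse x.reverse y.reverse
    (by simpa using h)
  refine ⟨L, R, ?_, ?_, ?_⟩
  · simpa [foldWord] using h1
  · simpa using h2
  · exact h3.trans (List.reverse_perm x)

theorem foldWord_total {α : Type} (x : List α) (y : List FDir) (h : x.length = y.length) :
    ∃ s, foldWord x y = some s ∧ s.Perm x := by
  obtain ⟨L, R, _, h1, _, h3⟩ := foldRev_append_aux [] [] x.reverse y.reverse (by simpa using h)
  exact ⟨L ++ R, h1, h3.trans (List.reverse_perm x)⟩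

theorem foldWord_snoc_up {α : Type} (w : List α) (v : List FDir) (a : α) :
    foldWord (w ++ [a]) (v ++ [FDir.up]) = (foldWord w v).map fun s => a :: s := by
  simp [foldWord, foldRev]

theorem foldWord_snoc_down {α : Type} (w : List α) (v : List FDir) (a : α) :
    foldWord (w ++ [a]) (v ++ [FDir.down]) = (foldWord w v).map fun s => s ++ [a] := by
  simp [foldWord, foldRev]

/-! ### Regular languages `h (xyz)⁺` -/

/-- `(xyz)^n`. -/
def flat3 {α : Type} (x y z : α) (n : ℕ) : List α := (List.replicate n [x, y, z]).flatten

theorem flat3_zero {α : Type} (x y z : α) : flat3 x y z 0 = [] := by simp [flat3]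

theorem flat3_succ {α : Type} (x y z : α) (n : ℕ) :
    flat3 x y z (n + 1) = x :: y :: z :: flat3 x y z n := by
  simp [flat3, List.replicate_succ]

theorem flat3_snoc {α : Type} (x y z : α) (n : ℕ) :
    flat3 x y z (n + 1) = flat3 x y z n ++ [x] ++ [y] ++ [z] := by
  simp [flat3, List.replicate_succ']

theorem flat3_length {α : Type} (x y z : α) (n : ℕ) : (flat3 x y z n).length = 3 * n := by
  induction n with
  | zero => simp [flat3_zero]
  | succ n ih => simp [flat3_succ, ih]; omega

/-- The language `h (xyz)⁺`. -/
def coreLang {α : Type} (h x y z : α) : Language α :=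
  { w | ∃ n, w = h :: flat3 x y z (n + 1) }

/-- The automaton for `h (xyz)⁺`. -/
def coreDFA {α : Type} [DecidableEq α] (h x y z : α) : DFA α (Fin 6) where
  step s c :=
    match s with
    | 0 => if c = h then 1 else 5
    | 1 => if c = x then 2 else 5
    | 2 => if c = y then 3 else 5
    | 3 => if c = z then 4 else 5
    | 4 => if c = x then 2 else 5
    | 5 => 5
  start := 0
  accept := {4}

theorem coreDFA_spec {α : Type} [DecidableEq α] (h x y z : α) (w : List α) :
    ((coreDFA h x y z).evalFrom 5 w ≠ 4) ∧
    ((coreDFA h x y z).evalFrom 4 w = 4 ↔ ∃ n, w = flat3 x y z n) ∧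
    ((coreDFA h x y z).evalFrom 3 w = 4 ↔ ∃ n, w = z :: flat3 x y z n) ∧
    ((coreDFA h x y z).evalFrom 2 w = 4 ↔ ∃ n, w = y :: z :: flat3 x y z n) ∧
    ((coreDFA h x y z).evalFrom 1 w = 4 ↔ ∃ n, w = x :: y :: z :: flat3 x y z n) := by
  induction w with
  | nil =>
    simp only [DFA.evalFrom_nil]
    refine ⟨by decide, ?_, ?_, ?_, ?_⟩
    · simp only [true_iff]; exact ⟨0, by simp [flat3_zero]⟩
    · simp
    · simp
    · simp
  | cons c w ih =>
    obtain ⟨h5, h4, h3, h2, h1⟩ := ih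
    have e5 : (coreDFA h x y z).step 5 c = 5 := rfl
    have e4 : (coreDFA h x y z).step 4 c = if c = x then 2 else 5 := rfl
    have e3 : (coreDFA h x y z).step 3 c = if c = z then 4 else 5 := rfl
    have e2 : (coreDFA h x y z).step 2 c = if c = y then 3 else 5 := rfl
    have e1 : (coreDFA h x y z).step 1 c = if c = x then 2 else 5 := rfl
    simp only [DFA.evalFrom_cons, e5, e4, e3, e2, e1]
    refine ⟨h5, ?_, ?_, ?_, ?_⟩
    · split_ifs with hc
      · rw [h2]
        constructor
        · rintro ⟨n, rfl⟩
          exact ⟨n + 1, by rw [flat3_succ, hc]⟩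
        · rintro ⟨n, hn⟩
          cases n with
          | zero => simp [flat3_zero] at hn
          | succ n =>
            rw [flat3_succ] at hn
            exact ⟨n, (List.cons.inj hn).2⟩
      · refine iff_of_false h5 ?_
        rintro ⟨n, hn⟩
        cases n with
        | zero => simp [flat3_zero] at hn
        | succ n =>
          rw [flat3_succ] at hn
          exact hc (List.cons.inj hn).1
    · split_ifs with hc
      · simp [h4, hc]
      · simp [h5, hc]
    · split_ifs with hc
      · simp [h3, hc]
      · simp [h5, hc]
    · split_ifs with hc
      · simp [h2, hc]
      · simp [h5, hc]

theorem coreLang_regular {α : Type} [DecidableEq α] (h x y z : α) :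
    (coreLang h x y z).IsRegular := by
  refine ⟨Fin 6, inferInstance, coreDFA h x y z, ?_⟩
  ext w
  rw [DFA.mem_accepts]
  change (coreDFA h x y z).evalFrom 0 w = 4 ↔ ∃ n, w = h :: flat3 x y z (n + 1)
  cases w with
  | nil => simp
  | cons c w =>
    have e0 : (coreDFA h x y z).step 0 c = if c = h then 1 else 5 := rfl
    obtain ⟨h5, _, _, _, h1⟩ := coreDFA_spec h x y z w
    simp only [DFA.evalFrom_cons, e0]
    split_ifs with hc
    · simp [h1, hc, flat3_succ]
    · simp [h5, hc]

/-! ### The two sublanguages -/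

theorem foldA (n : ℕ) :
    foldWord (Sym7.hash :: flat3 Sym7.a Sym7.b Sym7.c n)
      (FDir.down :: flat3 FDir.up FDir.down FDir.down n) =
    some (List.replicate n Sym7.a ++ [Sym7.hash] ++
          (List.replicate n [Sym7.b, Sym7.c]).flatten) := by
  induction n with
  | zero => simp [flat3_zero, foldWord, foldRev]
  | succ n ih =>
    rw [flat3_snoc, flat3_snoc]
    simp only [← List.cons_append]
    rw [foldWord_snoc_down, foldWord_snoc_down, foldWord_snoc_up, ih]
    rw [List.replicate_succ, List.replicate_succ']
    simp

theorem foldB (n : ℕ) :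
    foldWord (Sym7.hash :: flat3 Sym7.e Sym7.d Sym7.f n)
      (FDir.down :: flat3 FDir.up FDir.up FDir.down n) =
    some ((List.replicate n [Sym7.d, Sym7.e]).flatten ++ [Sym7.hash] ++
          List.replicate n Sym7.f) := by
  induction n with
  | zero => simp [flat3_zero, foldWord, foldRev]
  | succ n ih =>
    rw [flat3_snoc, flat3_snoc]
    simp only [← List.cons_append]
    rw [foldWord_snoc_down, foldWord_snoc_up, foldWord_snoc_up, ih]
    rw [List.replicate_succ, List.replicate_succ']
    simp

theorem FLangA : FLang (coreLang Sym7.hash Sym7.a Sym7.b Sym7.c)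
    (coreLang FDir.down FDir.up FDir.down FDir.down) = LpaperA := by
  ext s
  constructor
  · rintro ⟨w, ⟨n, rfl⟩, v, ⟨m, rfl⟩, hl, hs⟩
    have : n = m := by simp [flat3_length] at hl; omega
    subst this
    rw [foldA] at hs
    exact ⟨n + 1, by omega, (Option.some.inj hs).symm⟩
  · rintro ⟨n, hn, rfl⟩
    obtain ⟨m, rfl⟩ : ∃ m, n = m + 1 := ⟨n - 1, by omega⟩
    exact ⟨_, ⟨m, rfl⟩, _, ⟨m, rfl⟩, by simp [flat3_length], foldA _⟩

theorem FLangB : FLang (coreLang Sym7.hash Sym7.e Sym7.d Sym7.f)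
    (coreLang FDir.down FDir.up FDir.up FDir.down) = LpaperB := by
  ext s
  constructor
  · rintro ⟨w, ⟨n, rfl⟩, v, ⟨m, rfl⟩, hl, hs⟩
    have : n = m := by simp [flat3_length] at hl; omega
    subst this
    rw [foldB] at hs
    exact ⟨n + 1, by omega, (Option.some.inj hs).symm⟩
  · rintro ⟨n, hn, rfl⟩
    obtain ⟨m, rfl⟩ : ∃ m, n = m + 1 := ⟨n - 1, by omega⟩
    exact ⟨_, ⟨m, rfl⟩, _, ⟨m, rfl⟩, by simp [flat3_length], foldB _⟩

/-! ### The union -/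

theorem Lpaper_counts {s : List Sym7} (hs : s ∈ Lpaper) :
    s.count Sym7.a = s.count Sym7.b ∧ s.count Sym7.a = s.count Sym7.c ∧
    s.count Sym7.d = s.count Sym7.e ∧ s.count Sym7.d = s.count Sym7.f := by
  rcases hs with ⟨n, _, rfl⟩ | ⟨n, _, rfl⟩ <;>
    simp [List.count_append, List.count_flatten, List.count_replicate, List.count_cons]

/-- Any word of the union splits around `#`. -/
theorem Lpaper_split {s : List Sym7} (hs : s ∈ Lpaper) :
    ∃ P Q, s = P ++ Sym7.hash :: Q ∧ Sym7.hash ∉ P ∧ Sym7.hash ∉ Q ∧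
      ¬ (Sym7.a ∈ P ∧ Sym7.b ∈ P) ∧ ¬ (Sym7.e ∈ P ∧ Sym7.f ∈ P) ∧
      ¬ (Sym7.a ∈ Q ∧ Sym7.b ∈ Q) ∧ ¬ (Sym7.e ∈ Q ∧ Sym7.f ∈ Q) := by
  rcases hs with ⟨n, _, rfl⟩ | ⟨n, _, rfl⟩
  · exact ⟨List.replicate n Sym7.a, (List.replicate n [Sym7.b, Sym7.c]).flatten,
      by simp, by simp, by simp, by simp, by simp, by simp, by simp⟩
  · exact ⟨(List.replicate n [Sym7.d, Sym7.e]).flatten, List.replicate n Sym7.f,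
      by simp, by simp, by simp, by simp, by simp, by simp, by simp⟩

theorem infix_side {α : Type} {L m R P Q : List α} {c : α} (hm : c ∉ m)
    (h : L ++ (m ++ R) = P ++ c :: Q) : m ⊆ P ∨ m ⊆ Q := by
  rcases List.append_eq_append_iff.1 h with ⟨t, hP, ht⟩ | ⟨t, hL, ht⟩
  · rcases List.append_eq_append_iff.1 ht with ⟨t_p, h1, h2⟩ | ⟨t_p, h1, h2⟩
    · left
      intro q hq
      simp [hP, h1, hq]
    · cases t_p with
      | nil =>
        left
        intro q hq
        simp at h1
        simp [hP, ← h1, hq]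
      | cons q t_p =>
        exfalso
        simp at h2
        apply hm
        simp [h1, ← h2.1]
  · cases t with
    | nil =>
      cases m with
      | nil => left; simp
      | cons q m =>
        simp at ht
        exact absurd (by simp [ht.1]) hm
    | cons q t =>
      right
      simp at ht
      intro r hr
      simp [ht.2, hr]

/-- Simultaneous pumping (by deletion). -/
theorem pump_delete {α β : Type} {L₁ : Language α} {L₂ : Language β}
    (h₁ : L₁.IsRegular) (h₂ : L₂.IsRegular) :
    ∃ N : ℕ, ∀ w ∈ L₁, ∀ v ∈ L₂, ∃ i j, i < j ∧ j ≤ N ∧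
      w.take i ++ w.drop j ∈ L₁ ∧ v.take i ++ v.drop j ∈ L₂ := by
  have hf := (h₁.finite_range_leftQuotient).prod (h₂.finite_range_leftQuotient)
  refine ⟨hf.toFinset.card, fun w hw v hv => ?_⟩
  obtain ⟨i, hi, j, hj, hne, he⟩ :=
    Finset.exists_ne_map_eq_of_card_lt_of_maps_to (s := Finset.range (hf.toFinset.card + 1))
      (t := hf.toFinset) (f := fun i => (L₁.leftQuotient (w.take i), L₂.leftQuotient (v.take i)))
      (by simp) (by intro i _; simp)
  have key : ∀ i j, (L₁.leftQuotient (w.take i), L₂.leftQuotient (v.take i)) =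
      (L₁.leftQuotient (w.take j), L₂.leftQuotient (v.take j)) →
      w.take i ++ w.drop j ∈ L₁ ∧ v.take i ++ v.drop j ∈ L₂ := by
    intro i j he
    obtain ⟨e1, e2⟩ := Prod.mk.inj he
    constructor
    · have : w.drop j ∈ L₁.leftQuotient (w.take j) := by
        rw [Language.mem_leftQuotient, List.take_append_drop]; exact hw
      rw [← e1] at this
      exact this
    · have : v.drop j ∈ L₂.leftQuotient (v.take j) := by
        rw [Language.mem_leftQuotient, List.take_append_drop]; exact hv
      rw [← e2] at this
      exact this
  simp only [Finset.mem_range] at hi hj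
  rcases lt_or_gt_of_ne hne with hlt | hlt
  · exact ⟨i, j, hlt, by omega, key i j he⟩
  · exact ⟨j, i, hlt, by omega, key j i he.symm⟩

theorem main_bound {L₁ : Language Sym7} {L₂ : Language FDir}
    (h₁ : L₁.IsRegular) (h₂ : L₂.IsRegular) (hL : FLang L₁ L₂ = Lpaper) :
    ∃ N : ℕ, ∀ w ∈ L₁, ∀ v ∈ L₂, w.length = v.length → ∀ P Q,
      foldWord w v = some (P ++ Sym7.hash :: Q) → Sym7.hash ∉ P → Sym7.hash ∉ Q →
      P.length ≤ v.count FDir.up + N ∧ v.count FDir.up ≤ P.length + N := by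
  obtain ⟨N, hN⟩ := pump_delete h₁ h₂
  refine ⟨N, fun w hw v hv hl P Q hf hP hQ => ?_⟩
  have hmem : P ++ Sym7.hash :: Q ∈ Lpaper := by
    rw [← hL]; exact ⟨w, hw, v, hv, hl, hf⟩
  have hperm : (P ++ Sym7.hash :: Q).Perm w := by
    obtain ⟨s, hs, hp⟩ := foldWord_total w v hl
    rw [hf] at hs
    rwa [Option.some.inj hs]
  obtain ⟨s1, hs1, hp1⟩ := foldWord_total (w.take N) (v.take N) (by simp [hl])
  obtain ⟨L, R, hLR, hLlen, -⟩ := foldWord_append (w.take N) (w.drop N) (v.take N) (v.drop N)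
    (by simp [hl])
  rw [List.take_append_drop, List.take_append_drop, hf, hs1] at hLR
  have hs : L ++ (s1 ++ R) = P ++ Sym7.hash :: Q := by
    have := Option.some.inj hLR
    simpa using this.symm
  have hs1len : s1.length ≤ N := by
    rw [hp1.length_eq]; simp
  have hcount : v.count FDir.up = (v.take N).count FDir.up + L.length := by
    rw [hLlen, ← List.count_append, List.take_append_drop]
  have hcle : (v.take N).count FDir.up ≤ N :=
    List.count_le_length.trans (by simp)
  by_cases hh : Sym7.hash ∈ s1
  · obtain ⟨A, B, rfl⟩ := List.append_of_mem hh
    have hPA : P = L ++ A := by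
      have hc := congrArg (List.count Sym7.hash) hs
      have h0 : P.count Sym7.hash = 0 := List.count_eq_zero.2 hP
      have h0_p : Q.count Sym7.hash = 0 := List.count_eq_zero.2 hQ
      simp [h0, h0_p, List.count_append] at hc
      have hLA : Sym7.hash ∉ L ++ A := by
        rw [← List.count_eq_zero, List.count_append]
        omega
      have hs_p : (L ++ A) ++ Sym7.hash :: (B ++ R) = P ++ Sym7.hash :: Q := by
        rw [← hs]; simp
      rcases List.append_eq_append_iff.1 hs_p with ⟨t, e1, e2⟩ | ⟨t, e1, e2⟩
      · cases t with
        | nil => simpa using e1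
        | cons q t =>
          simp at e2
          exact absurd (by rw [e1]; simp [← e2.1]) hP
      · cases t with
        | nil => simpa using e1.symm
        | cons q t =>
          simp at e2
          exact absurd (by rw [e1]; simp [← e2.1]) hLA
    simp at hs1len
    have : P.length = L.length + A.length := by simp [hPA]
    omega
  · exfalso
    have hside := infix_side hh hs
    obtain ⟨P_p, Q_p, hPQ_p, hP_p_p, hQ_p_p, ha, hb, hc, hd⟩ := Lpaper_split hmem
    have hside_p := infix_side hh (hs.trans hPQ_p)
    have hno : ¬ (Sym7.a ∈ s1 ∧ Sym7.b ∈ s1) ∧ ¬ (Sym7.e ∈ s1 ∧ Sym7.f ∈ s1) := by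
      rcases hside_p with h | h
      · exact ⟨fun ⟨x, y⟩ => ha ⟨h x, h y⟩, fun ⟨x, y⟩ => hb ⟨h x, h y⟩⟩
      · exact ⟨fun ⟨x, y⟩ => hc ⟨h x, h y⟩, fun ⟨x, y⟩ => hd ⟨h x, h y⟩⟩
    obtain ⟨i, j, hij, hjN, hw_p, hv_p⟩ := hN w hw v hv
    obtain ⟨s_p, hs_p, hp_p⟩ := foldWord_total (w.take i ++ w.drop j) (v.take i ++ v.drop j)
      (by simp [hl])
    have hmem_p : s_p ∈ Lpaper := by
      rw [← hL]; exact ⟨_, hw_p, _, hv_p, by simp [hl], hs_p⟩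
    have hNw : N < w.length := by
      by_contra hcon
      have e : w.take N = w := List.take_of_length_le (by omega)
      rw [e] at hp1
      exact hh ((hp1.trans hperm.symm).mem_iff.2 (by simp))
    have hwd : w = w.take i ++ ((w.take j).drop i ++ w.drop j) := by
      have e1 : w.take i = (w.take j).take i := by
        rw [List.take_take, min_eq_left hij.le]
      rw [e1, ← List.append_assoc, List.take_append_drop, List.take_append_drop]
    have hylen : ((w.take j).drop i).length = j - i := by
      simp; omega
    have hysub : (w.take j).drop i ⊆ s1 := by
      intro q hq
      apply hp1.mem_iff.2
      have h1 : q ∈ w.take j := List.mem_of_mem_drop hq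
      have e : w.take j = (w.take N).take j := by
        rw [List.take_take, min_eq_left hjN]
      rw [e] at h1
      exact List.mem_of_mem_take h1
    generalize (w.take j).drop i = y at *
    have hcnt : ∀ q, (P ++ Sym7.hash :: Q).count q = s_p.count q + y.count q := by
      intro q
      rw [hperm.count_eq, hp_p.count_eq]
      conv_lhs => rw [hwd]
      simp only [List.count_append]
      omega
    obtain ⟨c1, c2, c3, c4⟩ := Lpaper_counts hmem
    obtain ⟨d1, d2, d3, d4⟩ := Lpaper_counts hmem_p
    simp only [hcnt] at c1 c2 c3 c4
    have hab : ¬ (0 < y.count Sym7.a ∧ 0 < y.count Sym7.b) := fun ⟨x, z⟩ =>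
      hno.1 ⟨hysub (List.count_pos_iff.1 x), hysub (List.count_pos_iff.1 z)⟩
    have hef : ¬ (0 < y.count Sym7.e ∧ 0 < y.count Sym7.f) := fun ⟨x, z⟩ =>
      hno.2 ⟨hysub (List.count_pos_iff.1 x), hysub (List.count_pos_iff.1 z)⟩
    obtain ⟨q, hq⟩ : ∃ q, q ∈ y := List.exists_mem_of_length_pos (by omega)
    have hqs := hysub hq
    have hqc := List.count_pos_iff.2 hq
    cases q
    case hash => exact hh hqs
    all_goals omega

theorem not_union : ¬ ∃ (L₁ : Language Sym7) (L₂ : Language FDir),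
    L₁.IsRegular ∧ L₂.IsRegular ∧ FLang L₁ L₂ = Lpaper := by
  rintro ⟨L₁, L₂, h₁, h₂, hL⟩
  obtain ⟨N, hN⟩ := main_bound h₁ h₂ hL
  have hA : List.replicate (2 * N + 1) Sym7.a ++ [Sym7.hash] ++
      (List.replicate (2 * N + 1) [Sym7.b, Sym7.c]).flatten ∈ FLang L₁ L₂ := by
    rw [hL]; exact Or.inl ⟨_, by omega, rfl⟩
  have hB : (List.replicate (2 * N + 1) [Sym7.d, Sym7.e]).flatten ++ [Sym7.hash] ++
      List.replicate (2 * N + 1) Sym7.f ∈ FLang L₁ L₂ := by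
    rw [hL]; exact Or.inr ⟨_, by omega, rfl⟩
  obtain ⟨w, hw, v, hv, hl, hf⟩ := hA
  obtain ⟨w_p, hw_p, v_p, hv_p, hl_p, hf_p⟩ := hB
  obtain ⟨s, hs, hp⟩ := foldWord_total w v hl
  obtain ⟨s_p, hs_p, hp_p⟩ := foldWord_total w_p v_p hl_p
  rw [hf] at hs
  rw [hf_p] at hs_p
  obtain rfl := Option.some.inj hs
  obtain rfl := Option.some.inj hs_p
  have hlen := hp.length_eq
  have hlen_p := hp_p.length_eq
  simp at hlen hlen_p
  have hl2 : w.length = v_p.length := by omega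
  obtain ⟨t, ht, hpt⟩ := foldWord_total w v_p hl2
  have htm : t ∈ Lpaper := by
    rw [← hL]; exact ⟨w, hw, v_p, hv_p, hl2, ht⟩
  have b1 := (hN w_p hw_p v_p hv_p hl_p _ _ (by rw [hf_p]; simp; rfl) (by simp) (by simp)).1
  have hca := (hpt.trans hp.symm).count_eq Sym7.a
  rcases htm with ⟨n, hn, rfl⟩ | ⟨n, hn, rfl⟩
  · have b2 := (hN w hw v_p hv_p hl2 (List.replicate n Sym7.a) _
      (by rw [ht]; simp; rfl) (by simp) (by simp)).2
    simp [List.count_append, List.count_flatten, List.count_replicate, List.count_cons] at hca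
    simp at b1 b2
    omega
  · simp [List.count_append, List.count_flatten, List.count_replicate, List.count_cons] at hca

/-- The class F(REG, REG) is not closed under union: `{ aⁿ#(bc)ⁿ : n ≥ 1 }` and
`{ (de)ⁿ#fⁿ : n ≥ 1 }` are each generated by an F-system with regular core and
regular folding procedure languages, but their union `Lpaper` is not. -/
theorem fsystem_not_closed_union :
    (∃ (L₁ : Language Sym7) (L₂ : Language FDir),
        L₁.IsRegular ∧ L₂.IsRegular ∧ FLang L₁ L₂ = LpaperA) ∧
    (∃ (L₁ : Language Sym7) (L₂ : Language FDir),
        L₁.IsRegular ∧ L₂.IsRegular ∧ FLang L₁ L₂ = LpaperB) ∧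
    ¬ ∃ (L₁ : Language Sym7) (L₂ : Language FDir),
        L₁.IsRegular ∧ L₂.IsRegular ∧ FLang L₁ L₂ = Lpaper := by
  exact ⟨⟨_, _, coreLang_regular _ _ _ _, coreLang_regular _ _ _ _, FLangA⟩,
    ⟨_, _, coreLang_regular _ _ _ _, coreLang_regular _ _ _ _, FLangB⟩, not_union⟩
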